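/- Let P be a finite poc set, U, W ultrafilters on P, and n ∈ ℕ with d∞(U,W) > n. Then there exists a proper element a ∈ U ∖ W (so that a⋆ ∈ W) such that every ultrafilter V on P containing a⋆ satisfies d∞(U,V) > n; that is, the wall {a, a⋆} separates W from the d∞-ball of radius n about U. -/

import Mathlib

/-- A *poc set*: a poset with least element `⊥` and an order-reversing involution
`pstar` such that `a ≤ pstar a → a = ⊥`. -/
class PocSet (P : Type) extends PartialOrder P, OrderBot P where
  pstar : P → P
  pstar_pstar : ∀ a : P, pstar (pstar a) = a
  pstar_antitone : ∀ {a b : P}, a ≤ b → pstar b ≤ pstar a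
  eq_bot_of_le_pstar : ∀ a : P, a ≤ pstar a → a = ⊥

namespace PocSet

variable {P : Type} [PocSet P]

/-- An *ultrafilter* on a poc set: a complete `⋆`-selection (for every `a`, exactly
one of `a`, `a⋆` belongs) which is coherent (no `a, b ∈ U` satisfy `a ≤ b⋆`). -/
def IsUltra (U : Set P) : Prop :=
  (∀ a : P, a ∈ U ↔ pstar a ∉ U) ∧ ∀ a ∈ U, ∀ b ∈ U, ¬ a ≤ pstar b

/-- Two elements are *nested* if one of the four nesting relations holds. -/
def Nested (a b : P) : Prop :=
  a ≤ b ∨ a ≤ pstar b ∨ pstar a ≤ b ∨ pstar a ≤ pstar b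

/-- A set is *nested* if its elements are pairwise nested. -/
def NestedSet (N : Set P) : Prop := ∀ a ∈ N, ∀ b ∈ N, Nested a b

/-- A set is *transverse* if no two distinct elements of it are nested. -/
def Transverse (A : Set P) : Prop := ∀ a ∈ A, ∀ b ∈ A, a ≠ b → ¬ Nested a b

/-- The set of minimal elements of `V` (w.r.t. the order induced from `P`). -/
def minset (V : Set P) : Set P := {a ∈ V | ∀ b ∈ V, b ≤ a → b = a}

/-- An element is *proper* if it is neither `0` nor `0⋆`. -/
def IsProper (a : P) : Prop := a ≠ ⊥ ∧ a ≠ pstar (⊥ : P)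

/-- `d∞(U,W)`: the maximum cardinality of a nested subset of `U \ W`. -/
noncomputable def dinfty (U W : Set P) : ℕ :=
  sSup {n : ℕ | ∃ N : Set P, N ⊆ U \ W ∧ NestedSet N ∧ N.ncard = n}

/-- The `ℓ¹`-distance between ultrafilters on a finite poc set: `|U \ W|`. -/
noncomputable def ellone (U W : Set P) : ℕ := (U \ W).ncard

end PocSet

open PocSet

namespace PocSet

variable {P : Type} [PocSet P] {U V W N : Set P} {a b : P}

theorem IsUltra.pstar_mem (hU : IsUltra U) (ha : a ∉ U) : pstar a ∈ U :=
  not_not.1 fun h => ha ((hU.1 a).2 h)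

theorem IsUltra.bot_notMem (hU : IsUltra U) : (⊥ : P) ∉ U :=
  fun h => hU.2 _ h _ h bot_le

/-- Nested elements separating two ultrafilters in the same direction are comparable. -/
theorem Nested.le_or_le (h : Nested a b) (hU : IsUltra U) (hW : IsUltra W)
    (ha : a ∈ U \ W) (hb : b ∈ U \ W) : a ≤ b ∨ b ≤ a := by
  rcases h with h | h | h | h
  · exact .inl h
  · exact absurd h (hU.2 a ha.1 b hb.1)
  · exact absurd ((pstar_pstar b).symm ▸ h)
      (hW.2 _ (hW.pstar_mem ha.2) _ (hW.pstar_mem hb.2))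
  · exact .inr (by simpa only [pstar_pstar] using pstar_antitone h)

theorem NestedSet.ncard_le_dinfty [Finite P] (hN : NestedSet N) (h : N ⊆ U \ V) :
    N.ncard ≤ dinfty U V := by
  refine le_csSup ⟨Nat.card P, ?_⟩ ⟨N, h, hN, rfl⟩
  rintro _ ⟨M, -, -, rfl⟩
  exact Set.ncard_le_card M

end PocSet

/-- Ball-separation: if `d∞(U,W) > n` then some wall `{a, a⋆}` with `a` proper,
`a ∈ U \ W` (so `a⋆ ∈ W`) separates `W` from the `d∞`-ball of radius `n` about
`U`: every ultrafilter containing `a⋆` lies at `d∞`-distance `> n` from `U`. -/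
theorem ball_separation {P : Type} [PocSet P] [Finite P]
    {U W : Set P} (hU : IsUltra U) (hW : IsUltra W)
    {n : ℕ} (hd : dinfty U W > n) :
    ∃ a : P, IsProper a ∧ a ∈ U ∧ a ∉ W ∧ pstar a ∈ W ∧
      ∀ V : Set P, IsUltra V → pstar a ∈ V → dinfty U V > n := by
  obtain ⟨m, ⟨N, hNUW, hN, rfl⟩, hnN⟩ := exists_lt_of_lt_csSup
    (show {m : ℕ | ∃ N : Set P, N ⊆ U \ W ∧ NestedSet N ∧ N.ncard = m}.Nonempty from
      ⟨0, ∅, by simp, by simp [NestedSet], by simp⟩) hd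
  have hne : N.Nonempty := Set.nonempty_of_ncard_ne_zero (by omega)
  obtain ⟨a, ha⟩ := N.toFinite.exists_maximal hne
  have ⟨haU, haW⟩ := hNUW ha.prop
  have haW' : pstar a ∈ W := hW.pstar_mem haW
  have hle : ∀ c ∈ N, c ≤ a := fun c hc =>
    ((hN c hc a ha.prop).le_or_le hU hW (hNUW hc) (hNUW ha.prop)).elim id
      fun h => ha.le_of_ge hc h
  refine ⟨a, ⟨?_, ?_⟩, haU, haW, haW', fun V hV haV => ?_⟩
  · rintro rfl
    exact hU.bot_notMem haU
  · rintro rfl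
    exact hW.bot_notMem (pstar_pstar (⊥ : P) ▸ haW')
  · refine hnN.trans_le (hN.ncard_le_dinfty fun c hc => ⟨(hNUW hc).1, fun hcV => ?_⟩)
    exact hV.2 c hcV _ haV ((pstar_pstar a).symm ▸ hle c hc)
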